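/- arXiv:2512.10297 — 2 statements merged into one kernel-verified Lean document; each statement's English description precedes it below -/
import Mathlib

section
/- For n ≥ 1 and t ≥ 1, the Möbius number of the t-fold Segre power B_n^{(t)} of the Boolean lattice B_n is given by μ(B_n^{(t)}) = (-1)^n w_n^{(t)}, where w_n^{(t)} is the number of t-tuples of permutations in the symmetric group S_n with no common ascent. -/
open scoped Classical

/-- The `t`-fold Segre power of a poset with rank function `rk`: tuples of equal rank, with the
order induced from the product order. -/
abbrev SegrePower {α : Type*} [PartialOrder α] (rk : α → ℕ) (t : ℕ) : Type _ :=
  {x : Fin t → α // ∀ i j, rk (x i) = rk (x j)}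

/-- The ascent set of a permutation `σ ∈ S_n` (1-indexed): the positions `i ∈ [n-1]` with
`σ(i) < σ(i+1)`. -/
def permAsc {n : ℕ} (σ : Equiv.Perm (Fin n)) : Set ℕ :=
  {i | ∃ h : 1 ≤ i ∧ i < n, σ ⟨i - 1, by omega⟩ < σ ⟨i, by omega⟩}

open scoped Classical in
/-- Every finite preorder is a locally finite order. -/
noncomputable instance (priority := low) {α : Type*} [Preorder α] [Fintype α] :
    LocallyFiniteOrder α := Fintype.toLocallyFiniteOrder

/-- The number of `t`-tuples of permutations in `S_n` with no common ascent. -/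
noncomputable def noCommonAscCount (n t : ℕ) : ℕ :=
  Set.ncard {σt : Fin t → Equiv.Perm (Fin n) | (⋂ j : Fin t, permAsc (σt j)) = ∅}

/-- The permutation of `Fin (k + l)` whose first `k` values are the elements of `S` in the order
prescribed by `τ`, and whose last `l` values are the elements of `Sᶜ` in increasing order. -/
def shufflePerm {k l : ℕ} (p : {S : Finset (Fin (k + l)) // S.card = k} × Equiv.Perm (Fin k)) :
    Equiv.Perm (Fin (k + l)) :=
  finSumFinEquiv.symm.trans ((Equiv.sumCongr p.2 (Equiv.refl (Fin l))).trans
    (finSumEquivOfFinset p.1.2 (by rw [Finset.card_compl, p.1.2, Fintype.card_fin]; omega)))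

lemma shufflePerm_castAdd {k l : ℕ}
    (p : {S : Finset (Fin (k + l)) // S.card = k} × Equiv.Perm (Fin k)) (i : Fin k) :
    shufflePerm p (Fin.castAdd l i) = p.1.1.orderEmbOfFin p.1.2 (p.2 i) := by
  simp [shufflePerm]

lemma shufflePerm_natAdd {k l : ℕ}
    (p : {S : Finset (Fin (k + l)) // S.card = k} × Equiv.Perm (Fin k)) (i : Fin l) :
    shufflePerm p (Fin.natAdd k i) = p.1.1ᶜ.orderEmbOfFin
      (by rw [Finset.card_compl, p.1.2, Fintype.card_fin]; omega) i := by
  simp [shufflePerm]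

lemma shufflePerm_injective {k l : ℕ} : Function.Injective (shufflePerm (k := k) (l := l)) := by
  have himage (p : {S : Finset (Fin (k + l)) // S.card = k} × Equiv.Perm (Fin k)) :
      Set.range (fun i : Fin k => shufflePerm p (Fin.castAdd l i)) = p.1.1 := by
    simp only [shufflePerm_castAdd]
    exact (p.2.surjective.range_comp (p.1.1.orderEmbOfFin p.1.2)).trans
      (Finset.range_orderEmbOfFin _ _)
  rintro ⟨⟨S, hS⟩, τ⟩ ⟨⟨S', hS'⟩, τ'⟩ h
  have hSS' : S = S' := by
    have h₁ := himage ⟨⟨S, hS⟩, τ⟩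
    rw [h, himage ⟨⟨S', hS'⟩, τ'⟩] at h₁
    exact (Finset.coe_injective h₁).symm
  subst hSS'
  refine Prod.ext rfl (Equiv.ext fun i => ?_)
  have hi := congrArg (fun σ => σ (Fin.castAdd l i)) h
  simpa only [shufflePerm_castAdd, EmbeddingLike.apply_eq_iff_eq] using hi

lemma mem_permAsc_shufflePerm_of_lt {k l : ℕ}
    (p : {S : Finset (Fin (k + l)) // S.card = k} × Equiv.Perm (Fin k)) {i : ℕ} (hi : i < k) :
    i ∈ permAsc (shufflePerm p) ↔ i ∈ permAsc p.2 := by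
  have h₁ (hi' : i - 1 < k) := shufflePerm_castAdd p ⟨i - 1, hi'⟩
  have h₂ := shufflePerm_castAdd p ⟨i, hi⟩
  simp only [Fin.castAdd_mk] at h₁ h₂
  simp only [permAsc, Set.mem_ofPred_eq, h₁ (by omega), h₂, OrderEmbedding.lt_iff_lt]
  constructor
  · rintro ⟨⟨h, _⟩, h'⟩
    exact ⟨⟨h, hi⟩, h'⟩
  · rintro ⟨⟨h, _⟩, h'⟩
    exact ⟨⟨h, by omega⟩, h'⟩

lemma Ioo_subset_permAsc_shufflePerm {k l : ℕ}
    (p : {S : Finset (Fin (k + l)) // S.card = k} × Equiv.Perm (Fin k)) :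
    Set.Ioo k (k + l) ⊆ permAsc (shufflePerm p) := by
  rintro i ⟨hki, hi⟩
  refine ⟨⟨by omega, hi⟩, ?_⟩
  have h₁ : (⟨i - 1, by omega⟩ : Fin (k + l)) = Fin.natAdd k ⟨i - 1 - k, by omega⟩ := by
    ext; simp; omega
  have h₂ : (⟨i, hi⟩ : Fin (k + l)) = Fin.natAdd k ⟨i - k, by omega⟩ := by
    ext; simp; omega
  rw [h₁, h₂, shufflePerm_natAdd, shufflePerm_natAdd, OrderEmbedding.lt_iff_lt, Fin.mk_lt_mk]
  omega

lemma exists_shufflePerm_eq {k l : ℕ} {σ : Equiv.Perm (Fin (k + l))}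
    (hσ : Set.Ioo k (k + l) ⊆ permAsc σ) : ∃ p, shufflePerm p = σ := by
  have hmono : StrictMono fun i : Fin l => σ (Fin.natAdd k i) := by
    cases l with
    | zero => exact fun i => i.elim0
    | succ l =>
      refine Fin.strictMono_iff_lt_succ.2 fun i => ?_
      obtain ⟨_, h⟩ := hσ (show k + (i + 1) ∈ Set.Ioo k (k + (l + 1)) by
        constructor <;> omega)
      exact h
  set S : Finset (Fin (k + l)) :=
    Finset.univ.image fun i : Fin k => σ (Fin.castAdd l i) with hSdef
  have hS : S.card = k :=
    (Finset.card_image_of_injective _ (σ.injective.comp (Fin.castAdd_injective k l))).trans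
      (by simp)
  have hSc : Sᶜ.card = l := by rw [Finset.card_compl, hS, Fintype.card_fin]; omega
  have hcompl (i : Fin l) : σ (Fin.natAdd k i) ∈ Sᶜ := by
    simp only [hSdef, Finset.mem_compl, Finset.mem_image, Finset.mem_univ, true_and,
      EmbeddingLike.apply_eq_iff_eq, not_exists]
    intro j h
    have := congrArg Fin.val h
    simp at this
    omega
  have hlast := Finset.orderEmbOfFin_unique hSc hcompl hmono
  have hfirst (i : Fin k) : ∃ j, S.orderEmbOfFin hS j = σ (Fin.castAdd l i) := by
    have : σ (Fin.castAdd l i) ∈ Set.range (S.orderEmbOfFin hS) := by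
      rw [Finset.range_orderEmbOfFin]
      exact Finset.mem_coe.2 (Finset.mem_image_of_mem _ (Finset.mem_univ i))
    exact this
  choose f hf using hfirst
  have hf_inj : Function.Injective f := fun i j hij => by
    have h := (hf i).symm.trans ((congrArg _ hij).trans (hf j))
    exact Fin.castAdd_injective k l (σ.injective h)
  refine ⟨⟨⟨S, hS⟩, Equiv.ofBijective f (Finite.injective_iff_bijective.1 hf_inj)⟩,
    Equiv.ext fun i => ?_⟩
  refine Fin.addCases (fun i => ?_) (fun i => ?_) i
  · rw [shufflePerm_castAdd]
    exact hf i
  · rw [shufflePerm_natAdd]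
    exact (congrFun hlast i).symm

lemma lt_of_mem_permAsc {n i : ℕ} {σ : Equiv.Perm (Fin n)} (h : i ∈ permAsc σ) :
    1 ≤ i ∧ i < n := h.1

/-- Tuples of permutations of `Fin (k + l)` whose common ascents contain all positions after `k`
and no position before `k`. -/
lemma ncard_commonAsc_shuffle (k l t : ℕ) (ht : 1 ≤ t) :
    Set.ncard {σt : Fin t → Equiv.Perm (Fin (k + l)) |
      (∀ i ∈ ⋂ j, permAsc (σt j), k ≤ i) ∧ Set.Ioo k (k + l) ⊆ ⋂ j, permAsc (σt j)} =
      (k + l).choose k ^ t * noCommonAscCount k t := by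
  let G : (Fin t → {S : Finset (Fin (k + l)) // S.card = k}) × (Fin t → Equiv.Perm (Fin k)) →
    Fin t → Equiv.Perm (Fin (k + l)) := fun p j => shufflePerm (p.1 j, p.2 j)
  have hG : Function.Injective G := fun p q h => by
    have h' (j : Fin t) := shufflePerm_injective (congrFun h j)
    exact Prod.ext (funext fun j => congrArg Prod.fst (h' j))
      (funext fun j => congrArg Prod.snd (h' j))
  have himage : {σt : Fin t → Equiv.Perm (Fin (k + l)) |
      (∀ i ∈ ⋂ j, permAsc (σt j), k ≤ i) ∧ Set.Ioo k (k + l) ⊆ ⋂ j, permAsc (σt j)} =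
      G '' (Set.univ ×ˢ {τt | (⋂ j : Fin t, permAsc (τt j)) = ∅}) := by
    ext σt
    constructor
    · rintro ⟨hlow, hhigh⟩
      choose p hp using fun j => exists_shufflePerm_eq (hhigh.trans (Set.iInter_subset _ j))
      refine ⟨⟨fun j => (p j).1, fun j => (p j).2⟩, ⟨trivial, ?_⟩, funext hp⟩
      refine Set.eq_empty_of_forall_notMem fun i hi => ?_
      have hi' := Set.mem_iInter.1 hi
      have hik := (lt_of_mem_permAsc (hi' ⟨0, ht⟩)).2
      refine absurd (hlow i (Set.mem_iInter.2 fun j => ?_)) (by omega)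
      rw [← hp j, mem_permAsc_shufflePerm_of_lt _ hik]
      exact hi' j
    · rintro ⟨⟨S, τt⟩, ⟨-, hτ⟩, rfl⟩
      refine ⟨fun i hi => ?_, Set.subset_iInter fun j => Ioo_subset_permAsc_shufflePerm _⟩
      by_contra! hik
      refine (Set.eq_empty_iff_forall_notMem.1 hτ i) (Set.mem_iInter.2 fun j => ?_)
      exact (mem_permAsc_shufflePerm_of_lt _ hik).1 (Set.mem_iInter.1 hi j)
  rw [himage, Set.ncard_image_of_injective _ hG, Set.ncard_prod, Set.ncard_univ,
    Nat.card_eq_fintype_card, Fintype.card_fun, Fintype.card_finset_len, Fintype.card_fin,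
    Fintype.card_fin, noCommonAscCount]

lemma sum_range_alternating_add_succ (e : ℕ → ℤ) (n : ℕ) :
    ∑ k ∈ Finset.range n, (-1 : ℤ) ^ k * (e k + e (k + 1)) = e 0 - (-1) ^ n * e n := by
  induction n with
  | zero => simp
  | succ n ih => rw [Finset.sum_range_succ, ih, pow_succ]; ring

/-- The Carlitz–Scoville–Vaughan recurrence for tuples of permutations without common ascents. -/
lemma sum_choose_pow_mul_noCommonAscCount {n t : ℕ} (hn : n ≠ 0) (ht : 1 ≤ t) :
    ∑ k ∈ Finset.range (n + 1),
      (n.choose k : ℤ) ^ t * ((-1) ^ k * (noCommonAscCount k t : ℤ)) = 0 := by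
  let D : (Fin t → Equiv.Perm (Fin n)) → Set ℕ := fun σt => ⋂ j, permAsc (σt j)
  have hD (σt) {i : ℕ} (hi : i ∈ D σt) : 1 ≤ i ∧ i < n :=
    lt_of_mem_permAsc (Set.mem_iInter.1 hi ⟨0, ht⟩)
  let e : ℕ → ℤ := fun k => (Set.ncard {σt | D σt = Set.Ico k n} : ℤ)
  have he₀ : e 0 = 0 := by
    have : {σt | D σt = Set.Ico 0 n} = ∅ := by
      refine Set.eq_empty_of_forall_notMem fun σt h => ?_
      have h0 : 0 ∈ D σt := by
        rw [show D σt = Set.Ico 0 n from h]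
        exact ⟨le_rfl, Nat.pos_of_ne_zero hn⟩
      exact absurd (hD σt h0).1 (by omega)
    simp [e, this]
  have hstep (k : ℕ) (hk : k < n) :
      (n.choose k : ℤ) ^ t * (noCommonAscCount k t : ℤ) = e k + e (k + 1) := by
    obtain ⟨l, rfl⟩ := Nat.exists_eq_add_of_lt hk
    have h := ncard_commonAsc_shuffle k (l + 1) t ht
    have hunion : {σt | (∀ i ∈ D σt, k ≤ i) ∧ Set.Ioo k (k + (l + 1)) ⊆ D σt} =
        {σt | D σt = Set.Ico k (k + l + 1)} ∪ {σt | D σt = Set.Ico (k + 1) (k + l + 1)} := by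
      ext σt
      have hlt (i : ℕ) (hi : i ∈ D σt) := (hD σt hi).2
      simp only [Set.mem_ofPred_eq, Set.mem_union, Set.ext_iff, Set.mem_Ico, Set.subset_def,
        Set.mem_Ioo]
      constructor
      · rintro ⟨h₁, h₂⟩
        by_cases hk : k ∈ D σt
        · left
          grind
        · right
          grind
      · rintro (h | h) <;> grind
    have hdisj : Disjoint {σt | D σt = Set.Ico k (k + l + 1)}
        {σt | D σt = Set.Ico (k + 1) (k + l + 1)} := by
      refine Set.disjoint_left.2 fun σt h₁ h₂ => ?_
      have := (Set.ext_iff.1 ((show D σt = _ from h₁).symm.trans h₂) k)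
      simp at this
    have hcard := Set.ncard_union_eq hdisj (Set.toFinite _) (Set.toFinite _)
    rw [← hunion] at hcard
    simp only [e]
    rw [← Nat.cast_add, ← hcard]
    exact_mod_cast h.symm
  have hlast : (noCommonAscCount n t : ℤ) = e n := by
    simp [e, D, noCommonAscCount]
  rw [Finset.sum_range_succ, Finset.sum_congr rfl fun k hk =>
    (mul_left_comm _ _ _).trans (congrArg _ (hstep k (Finset.mem_range.1 hk))),
    sum_range_alternating_add_succ, he₀, hlast]
  simp

/-- In the `t`-fold Segre power of a Boolean lattice, the number of elements of rank `k` below an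
element of rank `m` is `(m choose k) ^ t`. -/
lemma card_segrePower_le_filter_rank {n t : ℕ} (ht : 1 ≤ t)
    (y : SegrePower (fun s : Finset (Fin n) => s.card) t) (k : ℕ) :
    (Finset.univ.filter fun x : SegrePower (fun s : Finset (Fin n) => s.card) t =>
      x ≤ y ∧ (x.1 ⟨0, ht⟩).card = k).card = (y.1 ⟨0, ht⟩).card.choose k ^ t := by
  have h : ((Finset.univ.filter fun x : SegrePower (fun s : Finset (Fin n) => s.card) t =>
      x ≤ y ∧ (x.1 ⟨0, ht⟩).card = k).map (Function.Embedding.subtype _)) =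
      Fintype.piFinset fun j => (y.1 j).powersetCard k := by
    ext x
    simp only [Finset.mem_map, Finset.mem_filter, Finset.mem_univ, true_and,
      Function.Embedding.subtype_apply, Fintype.mem_piFinset, Finset.mem_powersetCard]
    constructor
    · rintro ⟨x, ⟨hxy, hx⟩, rfl⟩ j
      exact ⟨hxy j, (x.2 j ⟨0, ht⟩).trans hx⟩
    · intro hx
      exact ⟨⟨x, fun i j => (hx i).2.trans (hx j).2.symm⟩, ⟨fun j => (hx j).1, (hx _).2⟩, rfl⟩
  rw [← Finset.card_map, h, Fintype.card_piFinset,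
    Finset.prod_congr rfl fun j _ => (Finset.card_powersetCard k (y.1 j)).trans
      (congrArg (Nat.choose · k) (y.2 j ⟨0, ht⟩)), Finset.prod_const, Finset.card_univ,
    Fintype.card_fin]

lemma mu_segrePower_finset {n t : ℕ} (ht : 1 ≤ t)
    (y : SegrePower (fun s : Finset (Fin n) => s.card) t) :
    IncidenceAlgebra.mu ℤ
        (⟨fun _ => (∅ : Finset (Fin n)), fun _ _ => rfl⟩ :
          SegrePower (fun s : Finset (Fin n) => s.card) t) y =
      (-1 : ℤ) ^ (y.1 ⟨0, ht⟩).card * (noCommonAscCount (y.1 ⟨0, ht⟩).card t : ℤ) := by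
  set b : SegrePower (fun s : Finset (Fin n) => s.card) t :=
    ⟨fun _ => (∅ : Finset (Fin n)), fun _ _ => rfl⟩ with hb
  let F : SegrePower (fun s : Finset (Fin n) => s.card) t → ℤ := fun x =>
    (-1 : ℤ) ^ (x.1 ⟨0, ht⟩).card * (noCommonAscCount (x.1 ⟨0, ht⟩).card t : ℤ)
  have hbot (x : SegrePower (fun s : Finset (Fin n) => s.card) t) : b ≤ x :=
    fun j => Finset.empty_subset _
  induction y using WellFoundedLT.induction with
  | ind y ih =>
    by_cases hy : b = y
    · subst hy
      have hzero : noCommonAscCount 0 t = 1 := by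
        have : {σt : Fin t → Equiv.Perm (Fin 0) | (⋂ j : Fin t, permAsc (σt j)) = ∅} =
            Set.univ := Set.eq_univ_of_forall fun σt => Set.eq_empty_of_forall_notMem
          fun i hi => absurd (lt_of_mem_permAsc (Set.mem_iInter.1 hi ⟨0, ht⟩)).2 (by omega)
        rw [noCommonAscCount, this, Set.ncard_univ, Nat.card_eq_fintype_card]
        simp
      simp [hb, hzero]
    · have hcard : (y.1 ⟨0, ht⟩).card ≠ 0 := fun h => hy <| Subtype.ext <| funext fun j =>
        (Finset.card_eq_zero.1 ((y.2 j ⟨0, ht⟩).trans h)).symm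
      have hmaps : ∀ x ∈ Finset.Icc b y,
          (x.1 ⟨0, ht⟩).card ∈ Finset.range ((y.1 ⟨0, ht⟩).card + 1) := fun x hx =>
        Finset.mem_range_succ_iff.2 (Finset.card_le_card ((Finset.mem_Icc.1 hx).2 _))
      have hsum : ∑ x ∈ Finset.Icc b y, F x = 0 := by
        rw [← Finset.sum_fiberwise_of_maps_to hmaps,
          ← sum_choose_pow_mul_noCommonAscCount hcard ht]
        refine Finset.sum_congr rfl fun k _ => ?_
        rw [Finset.sum_congr rfl fun x hx => by
          simp only [F]; rw [(Finset.mem_filter.1 hx).2], Finset.sum_const, nsmul_eq_mul,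
          ← Nat.cast_pow, ← card_segrePower_le_filter_rank ht]
        congr 3
        ext x
        simp [hbot]
      rw [Finset.Icc_eq_cons_Ico (hbot y), Finset.sum_cons] at hsum
      rw [IncidenceAlgebra.mu_eq_neg_sum_Ico_of_ne hy,
        Finset.sum_congr rfl fun x hx => ih x (Finset.mem_Ico.1 hx).2]
      exact (eq_neg_of_add_eq_zero_left hsum).symm

/-- for `n ≥ 1` and `t ≥ 1`, the Möbius number of the `t`-fold Segre power of the
Boolean lattice `B_n` is `μ(B_n⁽ᵗ⁾) = (-1)^n w_n⁽ᵗ⁾`, where `w_n⁽ᵗ⁾` is the number of `t`-tuples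
of permutations in `S_n` with no common ascent. -/
theorem stmt13 (n t : ℕ) (hn : 1 ≤ n) (ht : 1 ≤ t) :
    IncidenceAlgebra.mu ℤ
        (⟨fun _ => (∅ : Finset (Fin n)), fun _ _ => rfl⟩ :
          SegrePower (fun s : Finset (Fin n) => s.card) t)
        (⟨fun _ => (Finset.univ : Finset (Fin n)), fun _ _ => rfl⟩ :
          SegrePower (fun s : Finset (Fin n) => s.card) t) =
      (-1 : ℤ) ^ n *
        (Set.ncard {σt : Fin t → Equiv.Perm (Fin n) |
          (⋂ j : Fin t, permAsc (σt j)) = ∅} : ℤ) := by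
  rw [mu_segrePower_finset ht, Finset.card_univ, Fintype.card_fin, noCommonAscCount]
end

section
/- Let q be a prime power, n ≥ 1, and t ≥ 1. Equip the subspace lattice B_n(q) with the edge labeling λ that assigns to each cover X ⋖ Y the unique element of f(A(Y)) \ f(A(X)) ⊆ [n]. Then the induced edge labeling λ^{(t)} on the t-fold Segre power B_n^{(t)}(q), defined by λ^{(t)}((X_1,…,X_t) ⋖ (Y_1,…,Y_t)) = (λ(X_1 ⋖ Y_1),…,λ(X_t ⋖ Y_t)) with values in the componentwise-ordered product [n]^t, is an EL-labeling of B_n^{(t)}(q). -/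
/-- Saturated (maximal) chains of length `r` from `a` to `b` in a poset. -/
def maxChains {α : Type*} [PartialOrder α] (a b : α) (r : ℕ) : Set (Fin (r + 1) → α) :=
  {c | c 0 = a ∧ c (Fin.last r) = b ∧ ∀ j : Fin r, c j.castSucc ⋖ c j.succ}

/-- The word of edge labels of a chain. -/
def chainWord {α Λ : Type*} (lab : α → α → Λ) {r : ℕ} (c : Fin (r + 1) → α) : List Λ :=
  List.ofFn fun j : Fin r => lab (c j.castSucc) (c j.succ)

/-- The chain `c` has an ascent at position `i ∈ [r-1]` (1-indexed). -/
def IsAscentAt {α Λ : Type*} [Preorder Λ] (lab : α → α → Λ) {r : ℕ}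
    (c : Fin (r + 1) → α) (i : ℕ) : Prop :=
  ∃ h : 1 ≤ i ∧ i < r,
    lab (c ⟨i - 1, by omega⟩) (c ⟨i, by omega⟩) < lab (c ⟨i, by omega⟩) (c ⟨i + 1, by omega⟩)

/-- The chain `c` has a descent at position `i ∈ [r-1]` (1-indexed). -/
def IsDescentAt {α Λ : Type*} [Preorder Λ] (lab : α → α → Λ) {r : ℕ}
    (c : Fin (r + 1) → α) (i : ℕ) : Prop :=
  ∃ h : 1 ≤ i ∧ i < r,
    ¬ lab (c ⟨i - 1, by omega⟩) (c ⟨i, by omega⟩) < lab (c ⟨i, by omega⟩) (c ⟨i + 1, by omega⟩)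

/-- The ascent set of a chain. -/
def ascSet {α Λ : Type*} [Preorder Λ] (lab : α → α → Λ) {r : ℕ} (c : Fin (r + 1) → α) : Set ℕ :=
  {i | IsAscentAt lab c i}

/-- The descent set of a chain. -/
def desSet {α Λ : Type*} [Preorder Λ] (lab : α → α → Λ) {r : ℕ} (c : Fin (r + 1) → α) : Set ℕ :=
  {i | IsDescentAt lab c i}

/-- An EL-labeling: in every interval `[x, y]` there is a unique increasing maximal chain, and
it lexicographically strictly precedes every other maximal chain of the interval.  (In a graded
poset with rank function `rk`, every maximal chain of `[x, y]` has length `rk y - rk x`.) -/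
def IsELLabeling {α Λ : Type*} [PartialOrder α] [Preorder Λ] (rk : α → ℕ) (lab : α → α → Λ) :
    Prop :=
  ∀ x y : α, x ≤ y →
    ∃ c ∈ maxChains x y (rk y - rk x),
      (chainWord lab c).Chain' (· < ·) ∧
        ∀ c' ∈ maxChains x y (rk y - rk x), c' ≠ c →
          ¬ (chainWord lab c').Chain' (· < ·) ∧
            List.Lex (· < ·) (chainWord lab c) (chainWord lab c')

/-- The componentwise edge labeling of the Segre power induced by an edge labeling of `P`. -/
def segreLab {α Λ : Type*} [PartialOrder α] (rk : α → ℕ) (t : ℕ) (lab : α → α → Λ) :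
    SegrePower rk t → SegrePower rk t → (Fin t → Λ) :=
  fun X Y i => lab (X.1 i) (Y.1 i)


/-- For a vector `v`, `fmax v` is the 1-indexed position of the right-most non-zero coordinate
of `v` (and `0` if `v = 0`). -/
noncomputable def fmax {F : Type*} [Zero F] {n : ℕ} (v : Fin n → F) : ℕ :=
  sSup {m : ℕ | ∃ i : Fin n, v i ≠ 0 ∧ m = (i : ℕ) + 1}

/-- `f(A(X))`: the set of 1-indexed positions of right-most non-zero coordinates of the nonzero
vectors of the subspace `X`. -/
def fAset {F : Type*} [Field F] {n : ℕ} (X : Submodule F (Fin n → F)) : Set ℕ :=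
  {m : ℕ | ∃ v ∈ X, v ≠ 0 ∧ fmax v = m}

section Flag

variable {F : Type*} [Field F] {n : ℕ}

theorem fmax_le_iff {v : Fin n → F} {m : ℕ} : fmax v ≤ m ↔ ∀ i : Fin n, m ≤ i → v i = 0 := by
  have hbdd : BddAbove {k : ℕ | ∃ i : Fin n, v i ≠ 0 ∧ k = (i : ℕ) + 1} :=
    ⟨n, by rintro _ ⟨i, -, rfl⟩; exact i.2⟩
  refine ⟨fun h i hi => ?_, fun h => csSup_le' ?_⟩
  · by_contra hv
    have : (i : ℕ) + 1 ≤ fmax v := le_csSup hbdd ⟨i, hv, rfl⟩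
    omega
  · rintro _ ⟨i, hv, rfl⟩
    by_contra hi
    exact hv (h i (by omega))

theorem fmax_le (v : Fin n → F) : fmax v ≤ n :=
  fmax_le_iff.2 fun i hi => absurd i.2 (by omega)

theorem fmax_eq_zero_iff {v : Fin n → F} : fmax v = 0 ↔ v = 0 := by
  rw [← Nat.le_zero, fmax_le_iff]
  simp [funext_iff]

/-- The subspace of vectors supported on the first `m` coordinates. -/
def initialSubspace (F : Type*) [Field F] (n m : ℕ) : Submodule F (Fin n → F) where
  carrier := {v | fmax v ≤ m}
  add_mem' {v w} hv hw := by
    simp only [Set.mem_ofPred_eq, fmax_le_iff] at *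
    intro i hi
    simp [hv i hi, hw i hi]
  zero_mem' := by simp [fmax_le_iff]
  smul_mem' a v hv := by
    simp only [Set.mem_ofPred_eq, fmax_le_iff] at *
    intro i hi
    simp [hv i hi]

theorem mem_initialSubspace {v : Fin n → F} {m : ℕ} :
    v ∈ initialSubspace F n m ↔ fmax v ≤ m := Iff.rfl

theorem initialSubspace_mono {l m : ℕ} (h : l ≤ m) : initialSubspace F n l ≤ initialSubspace F n m :=
  fun _ hv => le_trans (mem_initialSubspace.1 hv) h

theorem fAset_mono {X Y : Submodule F (Fin n → F)} (h : X ≤ Y) : fAset X ⊆ fAset Y :=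
  fun _ ⟨v, hv, hv0, hm⟩ => ⟨v, h hv, hv0, hm⟩

theorem finite_fAset (X : Submodule F (Fin n → F)) : (fAset X).Finite :=
  (Set.finite_Iic n).subset fun _ ⟨v, _, _, hm⟩ => hm ▸ fmax_le v

/-- A vector with last nonzero coordinate at `m + 1` can be reduced modulo another one. -/
theorem exists_fmax_sub_smul_le {v w : Fin n → F} {m : ℕ} (hv : fmax v ≤ m + 1)
    (hw : fmax w = m + 1) : ∃ a : F, fmax (v - a • w) ≤ m := by
  have hw' : ¬ fmax w ≤ m := by omega
  rw [fmax_le_iff] at hw'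
  push Not at hw'
  obtain ⟨i, hi, hwi⟩ := hw'
  have hwm := fmax_le_iff.1 hw.le
  have him : (i : ℕ) = m := by
    by_contra h
    exact hwi (hwm i (by omega))
  refine ⟨v i / w i, fmax_le_iff.2 fun j hj => ?_⟩
  rcases eq_or_ne j i with rfl | hji
  · simp [hwi]
  · have hj' : m + 1 ≤ (j : ℕ) := by
      have : (j : ℕ) ≠ i := fun h => hji (Fin.ext h)
      omega
    simp [hwm j hj', fmax_le_iff.1 hv j hj']

theorem fAset_inf_initialSubspace (X : Submodule F (Fin n → F)) (m : ℕ) :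
    fAset (X ⊓ initialSubspace F n m) = fAset X ∩ Set.Iic m := by
  ext k
  constructor
  · rintro ⟨v, hv, hv0, rfl⟩
    exact ⟨⟨v, hv.1, hv0, rfl⟩, hv.2⟩
  · rintro ⟨⟨v, hv, hv0, rfl⟩, hm⟩
    exact ⟨v, ⟨hv, hm⟩, hv0, rfl⟩

theorem finrank_inf_initialSubspace (X : Submodule F (Fin n → F)) (m : ℕ) :
    Module.finrank F ↥(X ⊓ initialSubspace F n m) = (fAset X ∩ Set.Iic m).ncard := by
  induction m with
  | zero =>
    have h : X ⊓ initialSubspace F n 0 = ⊥ := by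
      rw [eq_bot_iff]
      rintro v ⟨-, hv⟩
      simpa [mem_initialSubspace, fmax_eq_zero_iff] using hv
    rw [← fAset_inf_initialSubspace, h, finrank_bot, eq_comm, Set.ncard_eq_zero (finite_fAset _),
      Set.eq_empty_iff_forall_notMem]
    rintro k ⟨v, hv, hv0, -⟩
    exact hv0 hv
  | succ m ih =>
    by_cases hm : m + 1 ∈ fAset X
    · have hset : fAset X ∩ Set.Iic (m + 1) = insert (m + 1) (fAset X ∩ Set.Iic m) := by
        ext k
        simp only [Set.mem_inter_iff, Set.mem_Iic, Set.mem_insert_iff]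
        grind
      rw [hset, Set.ncard_insert_of_notMem (by simp)
        ((finite_fAset X).subset Set.inter_subset_left), ← ih]
      obtain ⟨w, hw, -, hwm⟩ := hm
      have hw' : w ∉ X ⊓ initialSubspace F n m := fun h => by
        have := mem_initialSubspace.1 h.2
        omega
      rw [← Submodule.finrank_sup_span_singleton hw']
      suffices h : X ⊓ initialSubspace F n (m + 1) =
          (X ⊓ initialSubspace F n m) ⊔ Submodule.span F {w} by rw [h]
      apply le_antisymm
      · rintro v ⟨hv, hvm⟩
        obtain ⟨a, ha⟩ := exists_fmax_sub_smul_le hvm hwm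
        rw [← sub_add_cancel v (a • w)]
        exact Submodule.add_mem_sup ⟨X.sub_mem hv (X.smul_mem a hw), ha⟩
          (Submodule.smul_mem _ _ (Submodule.mem_span_singleton_self w))
      · refine sup_le (inf_le_inf_left _ (initialSubspace_mono m.le_succ)) ?_
        rw [Submodule.span_singleton_le_iff_mem]
        exact ⟨hw, hwm.le⟩
    · have hset : fAset X ∩ Set.Iic (m + 1) = fAset X ∩ Set.Iic m := by
        ext k
        simp only [Set.mem_inter_iff, Set.mem_Iic]
        grind
      suffices h : X ⊓ initialSubspace F n (m + 1) = X ⊓ initialSubspace F n m by rw [hset, ← ih, h]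
      refine le_antisymm (fun v hv => ⟨hv.1, ?_⟩)
        (inf_le_inf_left _ (initialSubspace_mono m.le_succ))
      have h : fmax v ≤ m + 1 := hv.2
      by_contra hvm
      have hvm' : ¬ fmax v ≤ m := hvm
      refine hm ⟨v, hv.1, fun h0 => ?_, by omega⟩
      rw [fmax_eq_zero_iff.2 h0] at hvm'
      omega

theorem finrank_eq_ncard_fAset (X : Submodule F (Fin n → F)) :
    Module.finrank F X = (fAset X).ncard := by
  have h : X ≤ initialSubspace F n n := fun v _ => fmax_le v
  have := finrank_inf_initialSubspace X n
  rwa [← fAset_inf_initialSubspace, inf_eq_left.2 h] at this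

theorem eq_of_le_of_fAset_subset {X Y : Submodule F (Fin n → F)} (h : X ≤ Y)
    (hf : fAset Y ⊆ fAset X) : X = Y := by
  refine Submodule.eq_of_le_of_finrank_le h ?_
  rw [finrank_eq_ncard_fAset, finrank_eq_ncard_fAset]
  exact Set.ncard_le_ncard hf (finite_fAset X)

theorem inf_initialSubspace_le {Y Z : Submodule F (Fin n → F)} (h : Z ≤ Y) {m : ℕ}
    (hf : fAset Y ∩ Set.Iic m ⊆ fAset Z) : Y ⊓ initialSubspace F n m ≤ Z := by
  rw [← eq_of_le_of_fAset_subset (inf_le_inf_right (initialSubspace F n m) h)]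
  · exact inf_le_left
  · simp only [fAset_inf_initialSubspace]
    exact fun k hk => ⟨hf hk, hk.2⟩

/-- The edge label of a pair of subspaces. -/
noncomputable def flagLabel (X Y : Submodule F (Fin n → F)) : ℕ := sSup (fAset Y \ fAset X)

theorem fAset_diff_eq_singleton {X Y : Submodule F (Fin n → F)} (h : X ≤ Y)
    (hr : Module.finrank F Y = Module.finrank F X + 1) :
    fAset Y \ fAset X = {flagLabel X Y} := by
  have hcard : (fAset Y \ fAset X).ncard = 1 := by
    rw [Set.ncard_sdiff (fAset_mono h) (finite_fAset X), ← finrank_eq_ncard_fAset,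
      ← finrank_eq_ncard_fAset, hr, Nat.add_sub_cancel_left]
  obtain ⟨l, hl⟩ := Set.ncard_eq_one.1 hcard
  rw [flagLabel, hl, csSup_singleton]

theorem exists_minimal_label_step {X Y : Submodule F (Fin n → F)} (h : X ≤ Y)
    (hr : Module.finrank F X < Module.finrank F Y) :
    ∃ Z, X ≤ Z ∧ Z ≤ Y ∧ Module.finrank F Z = Module.finrank F X + 1 ∧
      ∀ m ∈ fAset Y \ fAset Z, flagLabel X Z < m := by
  have hne : (fAset Y \ fAset X).Nonempty := by
    rw [Set.sdiff_nonempty]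
    exact fun hf => hr.ne (by rw [eq_of_le_of_fAset_subset h hf])
  obtain ⟨⟨v, hv, hv0, hvm⟩, hmX⟩ := Nat.sInf_mem hne
  have hvX : v ∉ X := fun hX => hmX ⟨v, hX, hv0, hvm⟩
  have hXZ : X ≤ X ⊔ Submodule.span F {v} := le_sup_left
  have hvZ : v ∈ X ⊔ Submodule.span F {v} :=
    Submodule.mem_sup_right (Submodule.mem_span_singleton_self v)
  have hZr := Submodule.finrank_sup_span_singleton (K := F) hvX
  refine ⟨_, hXZ, sup_le h (by rwa [Submodule.span_singleton_le_iff_mem]), hZr, ?_⟩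
  rintro m ⟨hmY, hmZ⟩
  have hlab : fmax v = flagLabel X (X ⊔ Submodule.span F {v}) := by
    rw [← Set.mem_singleton_iff, ← fAset_diff_eq_singleton hXZ hZr, hvm]
    exact ⟨⟨v, hvZ, hv0, hvm⟩, hmX⟩
  have hle : sInf (fAset Y \ fAset X) ≤ m :=
    Nat.sInf_le ⟨hmY, fun hmX' => hmZ (fAset_mono hXZ hmX')⟩
  rw [← hlab]
  refine lt_of_le_of_ne (hvm ▸ hle) ?_
  rintro rfl
  exact hmZ ⟨v, hvZ, hv0, rfl⟩

/-- The first `r` steps of `c` are covering relations in the subspace lattice. -/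
def IsFlag (c : ℕ → Submodule F (Fin n → F)) (r : ℕ) : Prop :=
  ∀ j < r, c j ≤ c (j + 1) ∧ Module.finrank F (c (j + 1)) = Module.finrank F (c j) + 1

theorem exists_increasing_flag {X Y : Submodule F (Fin n → F)} (h : X ≤ Y) (r : ℕ)
    (hr : Module.finrank F Y = Module.finrank F X + r) :
    ∃ c : ℕ → Submodule F (Fin n → F), c 0 = X ∧ c r = Y ∧ IsFlag c r ∧
      ∀ j < r, ∀ m ∈ fAset Y \ fAset (c (j + 1)), flagLabel (c j) (c (j + 1)) < m := by
  induction r generalizing X with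
  | zero =>
    exact ⟨fun _ => X, rfl, Submodule.eq_of_le_of_finrank_eq h hr.symm,
      fun j hj => absurd hj (Nat.not_lt_zero j), fun j hj => absurd hj (Nat.not_lt_zero j)⟩
  | succ r ih =>
    obtain ⟨Z, hXZ, hZY, hZr, hZ⟩ := exists_minimal_label_step h (by omega)
    obtain ⟨c, rfl, hcr, hc, hmin⟩ := ih hZY (by omega)
    refine ⟨fun j => Nat.casesOn j X c, rfl, hcr, ?_, ?_⟩
    · rintro (_ | j) hj
      · exact ⟨hXZ, hZr⟩
      · exact hc j (by omega)
    · rintro (_ | j) hj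
      · exact hZ
      · exact hmin j (by omega)

namespace IsFlag

variable {c d : ℕ → Submodule F (Fin n → F)} {r : ℕ}

theorem le (hc : IsFlag c r) {j k : ℕ} (hjk : j ≤ k) (hk : k ≤ r) : c j ≤ c k := by
  induction k, hjk using Nat.le_induction with
  | base => exact le_rfl
  | succ k hjk ih => exact (ih (by omega)).trans (hc k (by omega)).1

theorem finrank_eq (hc : IsFlag c r) {k : ℕ} (hk : k ≤ r) :
    Module.finrank F (c k) = Module.finrank F (c 0) + k := by
  induction k with
  | zero => rfl
  | succ k ih => rw [(hc k (by omega)).2, ih (by omega), add_assoc]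

theorem mem_fAset_succ_iff (hc : IsFlag c r) {j : ℕ} (hj : j < r) {m : ℕ} :
    m ∈ fAset (c (j + 1)) ↔ m = flagLabel (c j) (c (j + 1)) ∨ m ∈ fAset (c j) := by
  have hs := Set.ext_iff.1 (fAset_diff_eq_singleton (hc j hj).1 (hc j hj).2) m
  have hm := @fAset_mono _ _ _ _ _ (hc j hj).1 m
  simp only [Set.mem_sdiff, Set.mem_singleton_iff] at hs
  tauto

theorem label_notMem (hc : IsFlag c r) {j : ℕ} (hj : j < r) :
    flagLabel (c j) (c (j + 1)) ∉ fAset (c j) := by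
  have h : flagLabel (c j) (c (j + 1)) ∈ fAset (c (j + 1)) \ fAset (c j) := by
    rw [fAset_diff_eq_singleton (hc j hj).1 (hc j hj).2]
    rfl
  exact h.2

theorem label_ne (hc : IsFlag c r) {j k : ℕ} (hjk : j < k) (hk : k < r) :
    flagLabel (c j) (c (j + 1)) ≠ flagLabel (c k) (c (k + 1)) := fun h =>
  hc.label_notMem hk <| h ▸ fAset_mono (hc.le (Nat.succ_le_of_lt hjk) hk.le)
    ((hc.mem_fAset_succ_iff (hjk.trans hk)).2 (Or.inl rfl))

theorem fAset_congr (hc : IsFlag c r) (hd : IsFlag d r) (h0 : c 0 = d 0) {k : ℕ} (hk : k ≤ r)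
    (hlab : ∀ j < k, flagLabel (c j) (c (j + 1)) = flagLabel (d j) (d (j + 1))) :
    fAset (c k) = fAset (d k) := by
  induction k with
  | zero => rw [h0]
  | succ k ih =>
    ext m
    rw [hc.mem_fAset_succ_iff hk, hd.mem_fAset_succ_iff hk, hlab k (by omega),
      ih (by omega) fun j hj => hlab j (by omega)]

theorem exists_label_eq (hc : IsFlag c r) {k l m : ℕ} (hkl : k ≤ l) (hl : l ≤ r)
    (hm : m ∈ fAset (c l)) (hm' : m ∉ fAset (c k)) :
    ∃ j, k ≤ j ∧ j < l ∧ flagLabel (c j) (c (j + 1)) = m := by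
  induction l, hkl using Nat.le_induction with
  | base => exact absurd hm hm'
  | succ l hkl ih =>
    rcases (hc.mem_fAset_succ_iff hl).1 hm with h | h
    · exact ⟨l, hkl, by omega, h.symm⟩
    · obtain ⟨j, hj, hjl, hjm⟩ := ih (by omega) h
      exact ⟨j, hj, by omega, hjm⟩

/-- The edge labels of the first `r` steps of `c` weakly increase. -/
def Increasing (c : ℕ → Submodule F (Fin n → F)) (r : ℕ) : Prop :=
  ∀ j k, j ≤ k → k < r → flagLabel (c j) (c (j + 1)) ≤ flagLabel (c k) (c (k + 1))

theorem label_le_of_agree (hc : IsFlag c r) (hinc : Increasing c r) (hd : IsFlag d r)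
    (h0 : c 0 = d 0) (hr : c r = d r) {k : ℕ} (hk : k < r)
    (hlab : ∀ j < k, flagLabel (c j) (c (j + 1)) = flagLabel (d j) (d (j + 1))) :
    flagLabel (c k) (c (k + 1)) ≤ flagLabel (d k) (d (k + 1)) := by
  have hmem : flagLabel (d k) (d (k + 1)) ∈ fAset (c r) := by
    rw [hr]
    exact fAset_mono (hd.le hk le_rfl) ((hd.mem_fAset_succ_iff hk).2 (Or.inl rfl))
  have hnot : flagLabel (d k) (d (k + 1)) ∉ fAset (c k) := by
    rw [hc.fAset_congr hd h0 hk.le hlab]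
    exact hd.label_notMem hk
  obtain ⟨j, hkj, hj, heq⟩ := hc.exists_label_eq hk.le le_rfl hmem hnot
  exact heq ▸ hinc k j hkj hj

theorem label_eq_of_increasing (hc : IsFlag c r) (hcinc : Increasing c r) (hd : IsFlag d r)
    (hdinc : Increasing d r) (h0 : c 0 = d 0) (hr : c r = d r) {k : ℕ} (hk : k < r) :
    flagLabel (c k) (c (k + 1)) = flagLabel (d k) (d (k + 1)) := by
  induction k using Nat.strong_induction_on with
  | _ k ih =>
    have hlab := fun j (hj : j < k) => ih j hj (hj.trans hk)
    exact le_antisymm (hc.label_le_of_agree hcinc hd h0 hr hk hlab)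
      (hd.label_le_of_agree hdinc hc h0.symm hr.symm hk fun j hj => (hlab j hj).symm)

theorem succ_eq_sup (hc : IsFlag c r) (hinc : Increasing c r) {k : ℕ} (hk : k < r) :
    c (k + 1) = c k ⊔ (c r ⊓ initialSubspace F n (flagLabel (c k) (c (k + 1)))) := by
  symm
  have hlow : fAset (c r) ∩ Set.Iic (flagLabel (c k) (c (k + 1))) ⊆ fAset (c (k + 1)) := by
    rintro m ⟨hm, hmk⟩
    by_contra hnot
    obtain ⟨j, hkj, hj, rfl⟩ := hc.exists_label_eq hk le_rfl hm hnot
    exact hc.label_ne hkj hj (le_antisymm (hinc k j (by omega) hj) hmk)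
  refine eq_of_le_of_fAset_subset
    (sup_le (hc k hk).1 (inf_initialSubspace_le (hc.le hk le_rfl) hlow)) fun m hm => ?_
  rcases (hc.mem_fAset_succ_iff hk).1 hm with h | h
  · refine fAset_mono le_sup_right ?_
    rw [fAset_inf_initialSubspace]
    exact ⟨fAset_mono (hc.le hk le_rfl) hm, h.le⟩
  · exact fAset_mono le_sup_left h

theorem eq_of_increasing (hc : IsFlag c r) (hcinc : Increasing c r) (hd : IsFlag d r)
    (hdinc : Increasing d r) (h0 : c 0 = d 0) (hr : c r = d r) {k : ℕ} (hk : k ≤ r) :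
    c k = d k := by
  induction k with
  | zero => exact h0
  | succ k ih =>
    rw [hc.succ_eq_sup hcinc hk, hd.succ_eq_sup hdinc hk,
      hc.label_eq_of_increasing hcinc hd hdinc h0 hr hk, ih (by omega), hr]

end IsFlag

end Flag

theorem lex_ofFn_of_first_lt {Λ : Type*} [Preorder Λ] {r : ℕ} {f g : Fin r → Λ} (k : Fin r)
    (heq : ∀ j < k, f j = g j) (hlt : f k < g k) :
    List.Lex (· < ·) (List.ofFn f) (List.ofFn g) := by
  induction r with
  | zero => exact k.elim0
  | succ r ih =>
    rw [List.ofFn_succ, List.ofFn_succ]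
    induction k using Fin.cases with
    | zero => exact .rel hlt
    | succ k =>
      rw [heq 0 k.succ_pos]
      exact .cons (ih k (fun j hj => heq j.succ (Fin.succ_lt_succ_iff.2 hj)) hlt)

section SegreFlag

variable {F : Type*} [Field F] {n t : ℕ}

/-- The `t`-fold Segre power of the subspace lattice of `F^n`. -/
abbrev SubspaceSegre (F : Type*) [Field F] (n t : ℕ) : Type _ :=
  SegrePower (fun W : Submodule F (Fin n → F) => Module.finrank F W) t

theorem SubspaceSegre.finrank_lt {X Y : SubspaceSegre F n t} (h : X < Y) (i : Fin t) :
    Module.finrank F (X.1 i) < Module.finrank F (Y.1 i) := by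
  by_contra hle
  refine h.ne (Subtype.ext (funext fun j => Submodule.eq_of_le_of_finrank_le (h.le j) ?_))
  have hX := X.2 i j
  have hY := Y.2 i j
  simp only at hX hY
  omega

theorem SubspaceSegre.covBy_of_finrank {X Y : SubspaceSegre F n t} (h : X ≤ Y) (i : Fin t)
    (hr : Module.finrank F (Y.1 i) = Module.finrank F (X.1 i) + 1) : X ⋖ Y := by
  refine ⟨lt_of_le_of_ne h ?_, fun Z hXZ hZY => ?_⟩
  · rintro rfl
    omega
  · have h1 := SubspaceSegre.finrank_lt hXZ i
    have h2 := SubspaceSegre.finrank_lt hZY i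
    omega

/-- The `i`-th component of a chain in the Segre power, extended to be eventually constant. -/
def chainComponent {r : ℕ} (C : Fin (r + 1) → SubspaceSegre F n t) (i : Fin t) (j : ℕ) :
    Submodule F (Fin n → F) :=
  (C ⟨min j r, by omega⟩).1 i

theorem chainComponent_of_le {r : ℕ} (C : Fin (r + 1) → SubspaceSegre F n t) (i : Fin t) {j : ℕ}
    (hj : j ≤ r) : chainComponent C i j = (C ⟨j, Nat.lt_succ_of_le hj⟩).1 i := by
  simp only [chainComponent, min_eq_left hj]

theorem segreLab_chain_apply {r : ℕ} (C : Fin (r + 1) → SubspaceSegre F n t) (j : Fin r)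
    (i : Fin t) :
    segreLab (fun W : Submodule F (Fin n → F) => Module.finrank F W) t flagLabel
      (C j.castSucc) (C j.succ) i =
      flagLabel (chainComponent C i j) (chainComponent C i (j + 1)) := by
  rw [chainComponent_of_le C i j.2.le, chainComponent_of_le C i (Nat.succ_le_of_lt j.2)]
  rfl

theorem isFlag_chainComponent {x y : SubspaceSegre F n t} {r : ℕ}
    {C : Fin (r + 1) → SubspaceSegre F n t} (hC : C ∈ maxChains x y r) (i : Fin t)
    (hr : Module.finrank F (y.1 i) = Module.finrank F (x.1 i) + r) :
    IsFlag (chainComponent C i) r := by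
  obtain ⟨h0, hlast, hcov⟩ := hC
  have hstep : ∀ j < r, chainComponent C i j ≤ chainComponent C i (j + 1) ∧
      Module.finrank F (chainComponent C i j) < Module.finrank F (chainComponent C i (j + 1)) := by
    intro j hj
    rw [chainComponent_of_le C i hj.le, chainComponent_of_le C i hj]
    exact ⟨(hcov ⟨j, hj⟩).le i, SubspaceSegre.finrank_lt (hcov ⟨j, hj⟩).lt i⟩
  have hgap : ∀ j k, j ≤ k → k ≤ r → Module.finrank F (chainComponent C i j) + (k - j) ≤
      Module.finrank F (chainComponent C i k) := by
    intro j k hjk hk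
    induction k, hjk using Nat.le_induction with
    | base => simp
    | succ k hjk ih =>
      have h1 := ih (by omega)
      have h2 := (hstep k hk).2
      omega
  have hx : chainComponent C i 0 = x.1 i := by
    rw [chainComponent_of_le C i (Nat.zero_le r), ← h0]
    rfl
  have hy : chainComponent C i r = y.1 i := by
    rw [chainComponent_of_le C i le_rfl, ← hlast]
    rfl
  intro j hj
  have h1 := hgap 0 j (Nat.zero_le j) hj.le
  have h2 := hgap (j + 1) r hj le_rfl
  have h3 := (hstep j hj).2
  rw [hx] at h1
  rw [hy] at h2
  exact ⟨(hstep j hj).1, by omega⟩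

theorem chain_eq_of_chainComponent_eq {r : ℕ} {C D : Fin (r + 1) → SubspaceSegre F n t}
    (h : ∀ i, ∀ j ≤ r, chainComponent C i j = chainComponent D i j) : C = D := by
  funext j
  refine Subtype.ext (funext fun i => ?_)
  have hj := Nat.le_of_lt_succ j.2
  simpa [chainComponent_of_le _ i hj] using h i j hj

theorem chain_chainWord_iff {r : ℕ} {C : Fin (r + 1) → SubspaceSegre F n t} (ht : 0 < t)
    (hC : ∀ i, IsFlag (chainComponent C i) r) :
    (chainWord (segreLab (fun W : Submodule F (Fin n → F) => Module.finrank F W) t flagLabel)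
      C).IsChain (· < ·) ↔ ∀ i, IsFlag.Increasing (chainComponent C i) r := by
  rw [chainWord, List.isChain_iff_pairwise, List.pairwise_ofFn]
  constructor
  · intro h i j k hjk hk
    rcases hjk.eq_or_lt with rfl | hjk
    · exact le_rfl
    · have := (h (i := ⟨j, hjk.trans hk⟩) (j := ⟨k, hk⟩) hjk).le i
      rwa [segreLab_chain_apply, segreLab_chain_apply] at this
  · intro h j k hjk
    refine lt_of_le_of_ne (fun i => ?_) fun heq => ?_
    · rw [segreLab_chain_apply, segreLab_chain_apply]
      exact h i j k (le_of_lt hjk) k.2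
    · have := congrFun heq ⟨0, ht⟩
      rw [segreLab_chain_apply, segreLab_chain_apply] at this
      exact (hC ⟨0, ht⟩).label_ne hjk k.2 this

theorem exists_increasing_chain {x y : SubspaceSegre F n t} (hxy : x ≤ y) (ht : 0 < t) (r : ℕ)
    (hr : ∀ i, Module.finrank F (y.1 i) = Module.finrank F (x.1 i) + r) :
    ∃ C ∈ maxChains x y r, ∀ i, IsFlag.Increasing (chainComponent C i) r := by
  choose c h0 hlast hflag hmin using fun i => exists_increasing_flag (hxy i) r (hr i)
  have hrank : ∀ j : Fin (r + 1), ∀ i i',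
      Module.finrank F (c i j) = Module.finrank F (c i' j) := by
    intro j i i'
    have hj := Nat.le_of_lt_succ j.2
    rw [(hflag i).finrank_eq hj, (hflag i').finrank_eq hj, h0, h0]
    exact congrArg (· + (j : ℕ)) (x.2 i i')
  have hcomp : ∀ i, ∀ j ≤ r, chainComponent
      (fun j : Fin (r + 1) => (⟨fun i => c i j, hrank j⟩ : SubspaceSegre F n t)) i j = c i j :=
    fun i j hj => chainComponent_of_le _ i hj
  refine ⟨fun j => ⟨fun i => c i j, hrank j⟩, ⟨Subtype.ext (funext h0), Subtype.ext (funext hlast),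
    fun j => SubspaceSegre.covBy_of_finrank (fun i => (hflag i j j.2).1) ⟨0, ht⟩
      (hflag ⟨0, ht⟩ j j.2).2⟩, fun i j k hjk hk => ?_⟩
  rw [hcomp i j (by omega), hcomp i (j + 1) (by omega), hcomp i k hk.le, hcomp i (k + 1) hk]
  rcases hjk.eq_or_lt with rfl | hjk
  · exact le_rfl
  · have hmem := fAset_mono ((hflag i).le hk le_rfl)
      (((hflag i).mem_fAset_succ_iff hk).2 (Or.inl rfl))
    rw [hlast] at hmem
    refine (hmin i j (hjk.trans hk) _ ⟨hmem, fun h => ?_⟩).le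
    exact (hflag i).label_notMem hk (fAset_mono ((hflag i).le hjk hk.le) h)

end SegreFlag

/-- equip the subspace lattice `B_n(q)` of `F_q^n` with the edge labeling `λ`
assigning to each cover `X ⋖ Y` the unique element of `f(A(Y)) \ f(A(X)) ⊆ [n]`.  Then the
induced componentwise labeling `λ⁽ᵗ⁾`, with values in the componentwise-ordered product `[n]ᵗ`,
is an EL-labeling of the `t`-fold Segre power `B_n⁽ᵗ⁾(q)`. -/
theorem stmt17 {F : Type*} [Field F] [Fintype F] (n : ℕ) (hn : 1 ≤ n) (t : ℕ) (ht : 1 ≤ t) :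
    IsELLabeling
      (fun X : SegrePower (fun W : Submodule F (Fin n → F) => Module.finrank F W) t =>
        Module.finrank F (X.1 ⟨0, ht⟩))
      (segreLab (fun W : Submodule F (Fin n → F) => Module.finrank F W) t
        (fun X Y : Submodule F (Fin n → F) => sSup (fAset Y \ fAset X))) := by
  intro x y hxy
  dsimp only
  set r := Module.finrank F (y.1 ⟨0, ht⟩) - Module.finrank F (x.1 ⟨0, ht⟩) with hrdef
  have hr : ∀ i, Module.finrank F (y.1 i) = Module.finrank F (x.1 i) + r := by
    intro i
    have hx := x.2 i ⟨0, ht⟩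
    have hy := y.2 i ⟨0, ht⟩
    have hle := Submodule.finrank_mono (hxy ⟨0, ht⟩)
    simp only at hx hy
    omega
  have hflag : ∀ D ∈ maxChains x y r, ∀ i, IsFlag (chainComponent D i) r :=
    fun D hD i => isFlag_chainComponent hD i (hr i)
  obtain ⟨C, hC, hinc⟩ := exists_increasing_chain hxy ht r hr
  refine ⟨C, hC, (chain_chainWord_iff ht (hflag C hC)).2 hinc, fun D hD hne => ?_⟩
  have h0 : ∀ i, chainComponent C i 0 = chainComponent D i 0 := fun i => by
    rw [chainComponent_of_le C i (Nat.zero_le r), chainComponent_of_le D i (Nat.zero_le r)]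
    exact congrFun (congrArg Subtype.val (hC.1.trans hD.1.symm)) i
  have hlast : ∀ i, chainComponent C i r = chainComponent D i r := fun i => by
    rw [chainComponent_of_le C i le_rfl, chainComponent_of_le D i le_rfl]
    exact congrFun (congrArg Subtype.val (hC.2.1.trans hD.2.1.symm)) i
  have hDinc : ¬ ∀ i, IsFlag.Increasing (chainComponent D i) r := fun hDinc =>
    hne (chain_eq_of_chainComponent_eq fun i j hj => ((hflag C hC i).eq_of_increasing (hinc i)
      (hflag D hD i) (hDinc i) (h0 i) (hlast i) hj).symm)
  refine ⟨fun h => hDinc ((chain_chainWord_iff ht (hflag D hD)).1 h), ?_⟩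
  let labels (E : Fin (r + 1) → SubspaceSegre F n t) (k : ℕ) (i : Fin t) : ℕ :=
    flagLabel (chainComponent E i k) (chainComponent E i (k + 1))
  have hdiff : ∃ k, k < r ∧ labels C k ≠ labels D k := by
    by_contra! hall
    refine hDinc fun i j k hjk hk => ?_
    exact (congrFun (hall j (by omega)) i).symm.trans_le
      ((hinc i j k hjk hk).trans_eq (congrFun (hall k hk) i))
  classical
  obtain ⟨hk, hkne⟩ := Nat.find_spec hdiff
  have hagree : ∀ j < Nat.find hdiff, labels C j = labels D j := fun j hj => by
    by_contra h
    exact Nat.find_min hdiff hj ⟨hj.trans hk, h⟩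
  have hword (E : Fin (r + 1) → SubspaceSegre F n t) :
      chainWord (segreLab (fun W : Submodule F (Fin n → F) => Module.finrank F W) t flagLabel) E =
        List.ofFn fun j : Fin r => labels E j :=
    congrArg List.ofFn (funext fun j => funext fun i => segreLab_chain_apply E j i)
  change List.Lex (· < ·)
    (chainWord (segreLab (fun W : Submodule F (Fin n → F) => Module.finrank F W) t flagLabel) C)
    (chainWord (segreLab (fun W : Submodule F (Fin n → F) => Module.finrank F W) t flagLabel) D)
  rw [hword, hword]
  refine lex_ofFn_of_first_lt ⟨Nat.find hdiff, hk⟩ (fun j hj => hagree j hj)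
    (lt_of_le_of_ne (fun i => ?_) hkne)
  exact (hflag C hC i).label_le_of_agree (hinc i) (hflag D hD i) (h0 i) (hlast i) hk
    fun j hj => congrFun (hagree j hj) i
end
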